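/- Let A = ⊕_{i∈ℤ} A_i be a commutative ℤ-graded ring such that the degree-zero subring A_0 is noetherian and A is finitely generated as an A_0-algebra, and let I ⊆ A be a homogeneous ideal. Then the ℕ-graded A_0-algebra ⊕_{n≥0} (I^n ∩ A_0), with multiplication induced by that of A (where I^0 = A), is finitely generated as an A_0-algebra. -/

import Mathlib

open Polynomial in
theorem Polynomial.prod_monomial_pow {R ι : Type*} [CommSemiring R] (s : Finset ι)
    (n : ι → ℕ) (a : ι → R) (m : ι → ℕ) :
    ∏ i ∈ s, monomial (n i) (a i) ^ m i =
      monomial (∑ i ∈ s, n i * m i) (∏ i ∈ s, a i ^ m i) := by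
  simp [← C_mul_X_pow_eq_monomial, mul_pow, Finset.prod_mul_distrib, ← pow_mul,
    Finset.prod_pow_eq_pow_sum, map_prod]

/-- A version of **Gordan's lemma**: the monomials of weight zero in finitely many weighted
elements of a commutative monoid are products of finitely many monomials of weight zero. -/
theorem exists_finset_prod_pow_mem_closure {ι G M : Type*} [Fintype ι] [AddCancelCommMonoid G]
    [CommMonoid M] (d : ι → G) (u : ι → M) :
    ∃ S : Finset M,
      (∀ s ∈ S, ∃ m : ι → ℕ, ∑ i, m i • d i = 0 ∧ ∏ i, u i ^ m i = s) ∧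
      ∀ m : ι → ℕ, ∑ i, m i • d i = 0 → ∏ i, u i ^ m i ∈ Submonoid.closure (S : Set M) := by
  classical
  let f : (ι → ℕ) →+ G :=
    { toFun m := ∑ i, m i • d i
      map_zero' := by simp
      map_add' := by simp [add_smul, Finset.sum_add_distrib] }
  let g : Multiplicative (ι → ℕ) →* M :=
    { toFun m := ∏ i, u i ^ m.toAdd i
      map_one' := by simp
      map_mul' := by simp [pow_add, Finset.prod_mul_distrib] }
  obtain ⟨K, hK⟩ := AddSubmonoid.fg_eqLocusM f 0
  have hmem (m : ι → ℕ) : m ∈ AddSubmonoid.closure (K : Set (ι → ℕ)) ↔ ∑ i, m i • d i = 0 := by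
    rw [hK]; rfl
  refine ⟨K.image fun m ↦ g (.ofAdd m), ?_, fun m hm ↦ ?_⟩
  · simp only [Finset.mem_image]
    rintro _ ⟨m, hm, rfl⟩
    exact ⟨m, (hmem m).1 (AddSubmonoid.subset_closure hm), rfl⟩
  · change g (.ofAdd m) ∈ _
    have hm' := (hmem m).2 hm
    clear hm
    induction hm' using AddSubmonoid.closure_induction with
    | mem m hm => exact Submonoid.subset_closure (Finset.mem_coe.2 (Finset.mem_image_of_mem _ hm))
    | zero => rw [ofAdd_zero, map_one]; exact one_mem _
    | add x y hx hy ihx ihy =>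
      rw [ofAdd_add, map_mul]
      exact mul_mem ihx ihy

theorem Ideal.IsHomogeneous.exists_finset_span_eq {ι σ A : Type*} [CommRing A] [IsNoetherianRing A]
    [SetLike σ A] [AddSubmonoidClass σ A] [DecidableEq ι] [AddMonoid ι] {𝒜 : ι → σ}
    [GradedRing 𝒜] {I : Ideal A} (hI : I.IsHomogeneous 𝒜) :
    ∃ F : Finset A, (∀ a ∈ F, SetLike.IsHomogeneousElem 𝒜 a) ∧ Ideal.span (F : Set A) = I := by
  obtain ⟨S, rfl⟩ := (Ideal.IsHomogeneous.iff_exists 𝒜 I).1 hI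
  obtain ⟨F, hF, h⟩ := (Submodule.fg_span_iff_fg_span_finset_subset _).1
    (IsNoetherian.noetherian (Ideal.span ((↑) '' S : Set A)))
  refine ⟨F, fun a ha ↦ ?_, h.symm⟩
  obtain ⟨x, -, rfl⟩ := hF ha
  exact x.2

open Polynomial in
/-- If `R` and a set `T` generate the `R`-algebra `A`, and `F` generates the ideal `I`, then the
Rees algebra of `I` is generated over `R` by `T` in degree zero and `F` in degree one. -/
theorem reesAlgebra_le_adjoin {R A : Type*} [CommRing R] [CommRing A] [Algebra R A] {T F : Set A}
    (hT : Algebra.adjoin R T = ⊤) {p : A[X]} (hp : p ∈ reesAlgebra (Ideal.span F)) :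
    p ∈ Algebra.adjoin R (C '' T ∪ monomial 1 '' F) := by
  have hC (a : A) : C a ∈ Algebra.adjoin R (C '' T ∪ monomial 1 '' F) := by
    have ha : C a ∈ (Algebra.adjoin R T).map (CAlgHom : A →ₐ[R] A[X]) :=
      ⟨a, by simp [hT], rfl⟩
    rw [AlgHom.map_adjoin] at ha
    exact Algebra.adjoin_mono Set.subset_union_left ha
  let D : Subalgebra A A[X] :=
    { Algebra.adjoin R (C '' T ∪ monomial 1 '' F) with algebraMap_mem' := hC }
  have hD : reesAlgebra (Ideal.span F) ≤ D := by
    rw [← adjoin_monomial_eq_reesAlgebra, Ideal.span, Submodule.map_span, Algebra.adjoin_span]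
    refine Algebra.adjoin_le fun x hx ↦ ?_
    exact Algebra.subset_adjoin (R := R) (Set.mem_union_right _ hx)
  exact hD hp

open Polynomial in
/-- Let `U` be a finite set of monomials with homogeneous coefficients. Then the polynomials in the
`𝒜 0`-algebra generated by `U` whose coefficients have degree zero form a finitely generated
algebra. -/
theorem exists_finset_adjoin_coeff_mem_zero {G σ A : Type*} [CommRing A] [SetLike σ A]
    [AddSubgroupClass σ A] [DecidableEq G] [AddCancelCommMonoid G] (𝒜 : G → σ) [GradedRing 𝒜]
    (U : Finset A[X]) (hU : ∀ u ∈ U, ∃ n d, ∃ a ∈ 𝒜 d, monomial n a = u) :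
    ∃ S : Finset A[X],
      (∀ s ∈ S, s ∈ Algebra.adjoin (𝒜 0) (U : Set A[X]) ∧ ∀ i, s.coeff i ∈ 𝒜 0) ∧
      ∀ p ∈ Algebra.adjoin (𝒜 0) (U : Set A[X]), (∀ i, p.coeff i ∈ 𝒜 0) →
        p ∈ Algebra.adjoin (𝒜 0) (S : Set A[X]) := by
  classical
  choose n d a ha hu using fun u : U ↦ hU u u.2
  have hprod (m : U → ℕ) : ∏ u : U, (u : A[X]) ^ m u =
      monomial (∑ u, n u * m u) (∏ u, a u ^ m u) := by
    simp_rw [← Polynomial.prod_monomial_pow, hu]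
  have hdeg (m : U → ℕ) : ∏ u, a u ^ m u ∈ 𝒜 (∑ u, m u • d u) :=
    SetLike.prod_pow_mem_graded _ _ _ _ fun u _ ↦ ha u
  obtain ⟨S, hS₁, hS₂⟩ := exists_finset_prod_pow_mem_closure d ((↑) : U → A[X])
  refine ⟨S, fun s hs ↦ ?_, fun p hp hp₀ ↦ ?_⟩
  · obtain ⟨m, hm, rfl⟩ := hS₁ s hs
    refine ⟨prod_mem fun u _ ↦ pow_mem (Algebra.subset_adjoin u.2) _, fun i ↦ ?_⟩
    rw [hprod, coeff_monomial]
    split_ifs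
    · exact hm ▸ hdeg m
    · exact zero_mem _
  · have key (k : ℕ) :
        monomial k (GradedRing.proj 𝒜 0 (p.coeff k)) ∈ Algebra.adjoin (𝒜 0) (S : Set A[X]) := by
      clear hp₀
      rw [← Subalgebra.mem_toSubmodule, Algebra.adjoin_eq_span] at hp
      induction hp using Submodule.span_induction with
      | zero => simp
      | add x y _ _ hx hy => simpa using add_mem hx hy
      | smul c x _ hx =>
        have hc : monomial k (GradedRing.proj 𝒜 0 ((c • x).coeff k)) =
            c • monomial k (GradedRing.proj 𝒜 0 (x.coeff k)) := by
          rw [coeff_smul, smul_monomial, GradedRing.proj_apply, GradedRing.proj_apply,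
            Algebra.smul_def, Algebra.smul_def]
          congr 1
          exact DirectSum.coe_decompose_mul_of_left_mem_zero 𝒜 c.2
        rw [hc]
        exact Subalgebra.smul_mem _ hx c
      | mem x hx =>
        have hx' : x ∈ Submonoid.closure (Set.range ((↑) : U → A[X])) := by simpa using hx
        obtain ⟨m, rfl⟩ := Submonoid.exists_of_mem_closure_range _ _ hx'
        by_cases hm : ∑ u, m u • d u = 0
        · have hmem : ∏ u : U, (u : A[X]) ^ m u ∈ Algebra.adjoin (𝒜 0) (S : Set A[X]) :=
            Submonoid.closure_le.2
              (show (S : Set A[X]) ⊆ (Algebra.adjoin (𝒜 0) (S : Set A[X])).toSubmonoid from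
                Algebra.subset_adjoin) (hS₂ m hm)
          rw [hprod] at hmem ⊢
          rw [GradedRing.proj_apply, coeff_monomial]
          split_ifs with hk
          · rwa [DirectSum.decompose_of_mem_same 𝒜 (hm ▸ hdeg m), ← hk]
          · simp
        · rw [hprod, GradedRing.proj_apply, coeff_monomial]
          split_ifs
          · rw [DirectSum.decompose_of_mem_ne 𝒜 (hdeg m) hm, map_zero]
            exact zero_mem _
          · simp
    rw [p.as_sum_support]
    refine sum_mem fun k _ ↦ ?_
    have := key k
    rwa [GradedRing.proj_apply, DirectSum.decompose_of_mem_same 𝒜 (hp₀ k)] at this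

theorem Algebra.adjoin_gradeZero_toSubring {G σ A B : Type*} [CommRing A] [CommRing B]
    [SetLike σ A] [AddSubgroupClass σ A] [DecidableEq G] [AddCommMonoid G] (𝒜 : G → σ)
    [GradedRing 𝒜] [Algebra A B] [Algebra (𝒜 0) B] [IsScalarTower (𝒜 0) A B] (s : Set B) :
    (Algebra.adjoin (𝒜 0) s).toSubring =
      Subring.closure (algebraMap A B '' (𝒜 0 : Set A) ∪ s) := by
  rw [Algebra.adjoin_eq_ring_closure, IsScalarTower.algebraMap_eq (𝒜 0) A B, RingHom.coe_comp,
    Set.range_comp]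
  congr
  exact Subtype.range_coe

/-- **Finite generation of the degree-zero part of the Rees algebra.**
Let `A = ⊕_{i∈ℤ} Aᵢ` be a commutative `ℤ`-graded ring such that `A₀` is
noetherian and `A` is a finitely generated `A₀`-algebra (i.e. `A` is generated
as a ring by `A₀` together with finitely many elements), and let `I ⊆ A` be a
homogeneous ideal.  Then the `ℕ`-graded `A₀`-algebra `⊕_{n≥0} (Iⁿ ∩ A₀)`, with
multiplication induced by that of `A`, is a finitely generated `A₀`-algebra.
We realize `⊕_{n≥0} (Iⁿ ∩ A₀)` concretely as the subset
`{p ∈ A[X] | ∀ i, p.coeff i ∈ Iⁱ ∩ A₀}` of the polynomial ring `A[X]` (whose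
multiplication is the one induced by that of `A`); finite generation as an
`A₀`-algebra says this subset is the subring generated by the constants
`C '' A₀` together with finitely many elements. -/
theorem degree_zero_rees_algebra_finitely_generated
    {A : Type*} [CommRing A] (𝒜 : ℤ → Submodule ℤ A) [GradedRing 𝒜]
    (hnoeth : IsNoetherianRing ↥(𝒜 0))
    (hfg : ∃ T : Finset A, Subring.closure ((𝒜 0 : Set A) ∪ (T : Set A)) = ⊤)
    (I : Ideal A) (hI : I.IsHomogeneous 𝒜) :
    ∃ S : Finset (Polynomial A),
      (Subring.closure ((Polynomial.C '' (𝒜 0 : Set A)) ∪ (S : Set (Polynomial A)))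
          : Set (Polynomial A))
        = {p : Polynomial A | ∀ i : ℕ, p.coeff i ∈ I ^ i ∧ p.coeff i ∈ 𝒜 0} := by
  classical
  obtain ⟨T, hT⟩ := hfg
  have hft : Algebra.FiniteType (𝒜 0) A := ⟨T, by
    rw [← Subalgebra.toSubring_injective.eq_iff, Algebra.adjoin_gradeZero_toSubring 𝒜]
    simpa using hT⟩
  have : IsNoetherianRing A := Algebra.FiniteType.isNoetherianRing (𝒜 0) A
  obtain ⟨T, hT, hT'⟩ := GradedAlgebra.exists_finset_adjoin_eq_top_and_homogeneous 𝒜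
  obtain ⟨F, hF, rfl⟩ := hI.exists_finset_span_eq
  obtain ⟨S, hS, hS'⟩ := exists_finset_adjoin_coeff_mem_zero 𝒜
    (T.image Polynomial.C ∪ F.image (Polynomial.monomial 1)) (by
      simp only [Finset.mem_union, Finset.mem_image]
      rintro _ (⟨a, ha, rfl⟩ | ⟨a, ha, rfl⟩)
      · obtain ⟨d, hd⟩ := hT' a ha
        exact ⟨0, d, a, hd, rfl⟩
      · obtain ⟨d, hd⟩ := hF a ha
        exact ⟨1, d, a, hd, rfl⟩)
  simp only [Finset.coe_union, Finset.coe_image] at hS hS'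
  have hrees : Algebra.adjoin (𝒜 0)
      (Polynomial.C '' (T : Set A) ∪ Polynomial.monomial 1 '' (F : Set A)) ≤
      (reesAlgebra (Ideal.span (F : Set A))).restrictScalars (𝒜 0) := by
    refine Algebra.adjoin_le ?_
    rintro _ (⟨a, -, rfl⟩ | ⟨a, ha, rfl⟩)
    · exact Subalgebra.algebraMap_mem (reesAlgebra _) a
    · exact reesAlgebra.monomial_mem.2 (by simpa using Ideal.subset_span ha)
  refine ⟨S, Set.Subset.antisymm (fun p hp ↦ ?_) fun p hp ↦ ?_⟩
  · have hle : Subring.closure (Polynomial.C '' (𝒜 0 : Set A) ∪ S) ≤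
        (reesAlgebra (Ideal.span (F : Set A))).toSubring ⊓
          RingHom.range (R := Polynomial (𝒜 0)) (Polynomial.mapRingHom (algebraMap (𝒜 0) A)) := by
      refine Subring.closure_le.2 (Set.union_subset ?_ fun s hs ↦ ⟨hrees (hS s hs).1, ?_⟩)
      · rintro _ ⟨a, ha, rfl⟩
        exact ⟨Subalgebra.algebraMap_mem _ a, Polynomial.C ⟨a, ha⟩, Polynomial.map_C _⟩
      · exact Polynomial.mem_map_range _ |>.2 fun i ↦ ⟨⟨_, (hS s hs).2 i⟩, rfl⟩
    obtain ⟨hp₁, q, rfl⟩ := hle hp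
    refine fun i ↦ ⟨hp₁ i, ?_⟩
    simp
  · have := hS' p (reesAlgebra_le_adjoin hT fun i ↦ (hp i).1) fun i ↦ (hp i).2
    rwa [← Subalgebra.mem_toSubring, Algebra.adjoin_gradeZero_toSubring 𝒜] at this
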